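/- Let S and A be standard Borel measurable spaces, let μ be a probability measure on S, and let κ_b, κ_φ be Markov kernels from S to A. Define the mixture kernel κ_m by κ_m(s) = (1/2)·κ_b(s) + (1/2)·κ_φ(s) for each s, and the joint measures μ ⊗ κ_b, μ ⊗ κ_φ, μ ⊗ κ_m on S × A (composition-product of μ with the kernel). Then JSD(μ ⊗ κ_b, μ ⊗ κ_φ) = ∫_S JSD(κ_b(s), κ_φ(s)) dμ(s); that is, the Jensen–Shannon divergence between the state-action joint distributions π_b(a|s)d_b(s) and π_φ(a|s)d_b(s) equals the μ-expectation of the Jensen–Shannon divergence between the state-conditional action distributions. -/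

import Mathlib

open MeasureTheory ProbabilityTheory
open scoped ENNReal

/-- The Kullback–Leibler divergence `KL(P ‖ Q) = ∫ log (dP/dQ) dP` (as a real number;
this is the correct value whenever `P ≪ Q` and the log-likelihood ratio is
`P`-integrable, as is always the case for the divergences of a measure against a
mixture containing it). -/
noncomputable def klReal {α : Type*} [MeasurableSpace α] (P Q : Measure α) : ℝ :=
  ∫ x, Real.log (P.rnDeriv Q x).toReal ∂P

/-- The Jensen–Shannon divergence
`JSD(P, Q) = (1/2)·KL(P ‖ M) + (1/2)·KL(Q ‖ M)` with `M = (1/2)·P + (1/2)·Q`. -/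
noncomputable def jsd {α : Type*} [MeasurableSpace α] (P Q : Measure α) : ℝ :=
  (1 / 2) * klReal P ((2⁻¹ : ℝ≥0∞) • P + (2⁻¹ : ℝ≥0∞) • Q)
    + (1 / 2) * klReal Q ((2⁻¹ : ℝ≥0∞) • P + (2⁻¹ : ℝ≥0∞) • Q)

namespace MeasureTheory.Measure

variable {α β : Type*} {mα : MeasurableSpace α} {mβ : MeasurableSpace β}

lemma rnDeriv_le_of_le_smul {P Q : Measure α} [SigmaFinite Q] {c : ℝ≥0∞} (h : P ≤ c • Q) :
    ∀ᵐ x ∂Q, P.rnDeriv Q x ≤ c := by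
  refine ae_le_of_forall_setLIntegral_le_of_sigmaFinite (P.measurable_rnDeriv Q) fun s _ _ ↦ ?_
  rw [setLIntegral_const]
  exact (setLIntegral_rnDeriv_le s).trans (h s)

/-- The log-likelihood ratio of a measure with respect to a measure dominating it up to a finite
constant is integrable. -/
lemma integrable_llr_of_le_smul {P Q : Measure α} [IsFiniteMeasure P] [IsFiniteMeasure Q]
    {c : ℝ≥0∞} (hc : c ≠ ∞) (h : P ≤ c • Q) : Integrable (llr P Q) P := by
  have hac : P ≪ Q := absolutelyContinuous_of_le_smul h
  rw [← InformationTheory.integrable_klFun_rnDeriv_iff hac]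
  obtain ⟨C, hC⟩ := (isCompact_Icc (a := (0 : ℝ)) (b := c.toReal)).exists_bound_of_continuousOn
    InformationTheory.continuous_klFun.continuousOn
  refine Integrable.of_bound (C := C) (StronglyMeasurable.aestronglyMeasurable (by fun_prop)) ?_
  filter_upwards [rnDeriv_le_of_le_smul h] with x hx
  exact hC _ ⟨ENNReal.toReal_nonneg, ENNReal.toReal_mono hc hx⟩

/-- The Radon-Nikodym derivative `∂(μ ⊗ₘ κ)/∂(μ ⊗ₘ η)` is the kernel Radon-Nikodym derivative. -/
lemma rnDeriv_compProd_right [MeasurableSpace.CountableOrCountablyGenerated α β]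
    {μ : Measure α} [IsFiniteMeasure μ] {κ η : Kernel α β} [IsFiniteKernel κ] [IsFiniteKernel η]
    (h : ∀ᵐ a ∂μ, κ a ≪ η a) :
    (μ ⊗ₘ κ).rnDeriv (μ ⊗ₘ η) =ᵐ[μ ⊗ₘ η] fun p ↦ κ.rnDeriv η p.1 p.2 := by
  have hκ : κ =ᵐ[μ] η.withDensity (κ.rnDeriv η) := by
    filter_upwards [h] with a ha using (Kernel.withDensity_rnDeriv_eq ha).symm
  rw [compProd_congr hκ, compProd_withDensity (by fun_prop)]
  exact rnDeriv_withDensity _ (by fun_prop)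

lemma compProd_le_smul_compProd {μ : Measure α} [SFinite μ] {κ η : Kernel α β}
    [IsSFiniteKernel κ] [IsSFiniteKernel η] {c : ℝ≥0∞} (h : ∀ a, κ a ≤ c • η a) :
    μ ⊗ₘ κ ≤ c • (μ ⊗ₘ η) := by
  refine Measure.le_iff.2 fun s hs ↦ ?_
  rw [smul_apply, smul_eq_mul, compProd_apply hs, compProd_apply hs,
    ← lintegral_const_mul _ (Kernel.measurable_kernel_prodMk_left hs)]
  exact lintegral_mono fun a ↦ h a _

end MeasureTheory.Measure

/-- Chain rule for the Kullback–Leibler divergence of two kernels with bounded density. -/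
lemma integrable_klReal_and_klReal_compProd {α β : Type*} {mα : MeasurableSpace α}
    {mβ : MeasurableSpace β} [MeasurableSpace.CountableOrCountablyGenerated α β]
    (μ : Measure α) [IsFiniteMeasure μ] (κ η : Kernel α β) [IsFiniteKernel κ] [IsFiniteKernel η]
    {c : ℝ≥0∞} (hc : c ≠ ∞) (h : ∀ a, κ a ≤ c • η a) :
    Integrable (fun a ↦ klReal (κ a) (η a)) μ ∧
      klReal (μ.compProd κ) (μ.compProd η) = ∫ a, klReal (κ a) (η a) ∂μ := by
  have hle : μ.compProd κ ≤ c • μ.compProd η := Measure.compProd_le_smul_compProd h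
  have hac a : κ a ≪ η a := Measure.absolutelyContinuous_of_le_smul (h a)
  have h_int := Measure.integrable_llr_of_le_smul hc hle
  have hjoint := (Measure.absolutelyContinuous_of_le_smul hle).ae_le
    (Measure.rnDeriv_compProd_right (ae_of_all μ hac))
  have hae : ∀ᵐ a ∂μ,
      ∫ b, llr (μ.compProd κ) (μ.compProd η) (a, b) ∂κ a = klReal (κ a) (η a) := by
    filter_upwards [Measure.ae_ae_of_ae_compProd hjoint] with a ha
    refine integral_congr_ae ?_
    filter_upwards [ha, (hac a).ae_le (Kernel.rnDeriv_eq_rnDeriv_measure (κ := κ) (η := η))]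
      with b hb hb'
    simp only [llr]
    rw [hb, hb']
  have h_int_inner :
      Integrable (fun a ↦ ∫ b, llr (μ.compProd κ) (μ.compProd η) (a, b) ∂κ a) μ := by
    simpa using Integrable.integral_compProd h_int
  refine ⟨h_int_inner.congr hae, ?_⟩
  exact (Measure.integral_compProd h_int).trans (integral_congr_ae hae)

/-- Chain rule for the Jensen–Shannon divergence: for a probability measure `μ` on a
standard Borel space `S` and Markov kernels `κ_b, κ_φ` from `S` to a standard Borel
space `A`, with mixture kernel `κ_m(s) = (1/2)·κ_b(s) + (1/2)·κ_φ(s)`, the JSD between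
the joint measures `μ ⊗ κ_b` and `μ ⊗ κ_φ` equals the `μ`-expectation of the
state-conditional JSD. -/
theorem jsd_compProd {S A : Type*} [MeasurableSpace S] [StandardBorelSpace S]
    [MeasurableSpace A] [StandardBorelSpace A]
    (μ : Measure S) [IsProbabilityMeasure μ]
    (κb κφ κm : Kernel S A) [IsMarkovKernel κb] [IsMarkovKernel κφ] [IsMarkovKernel κm]
    (hκm : ∀ s, κm s = (2⁻¹ : ℝ≥0∞) • κb s + (2⁻¹ : ℝ≥0∞) • κφ s) :
    jsd (μ.compProd κb) (μ.compProd κφ) = ∫ s, jsd (κb s) (κφ s) ∂μ := by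
  have hmix : (2⁻¹ : ℝ≥0∞) • μ.compProd κb + (2⁻¹ : ℝ≥0∞) • μ.compProd κφ = μ.compProd κm := by
    ext t ht
    have hb := Kernel.measurable_kernel_prodMk_left (κ := κb) ht
    have hφ := Kernel.measurable_kernel_prodMk_left (κ := κφ) ht
    simp only [Measure.add_apply, Measure.smul_apply, smul_eq_mul, Measure.compProd_apply ht, hκm]
    rw [lintegral_add_left (hb.const_mul _), lintegral_const_mul _ hb, lintegral_const_mul _ hφ]
  have hle_left (P Q : Measure A) : P ≤ (2 : ℝ≥0∞) • ((2⁻¹ : ℝ≥0∞) • P + (2⁻¹ : ℝ≥0∞) • Q) := by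
    rw [smul_add, smul_smul, smul_smul, ENNReal.mul_inv_cancel two_ne_zero ENNReal.ofNat_ne_top,
      one_smul, one_smul]
    exact Measure.le_add_right le_rfl
  have hb s : κb s ≤ (2 : ℝ≥0∞) • κm s := hκm s ▸ hle_left _ _
  have hφ s : κφ s ≤ (2 : ℝ≥0∞) • κm s := by
    rw [hκm s, add_comm]
    exact hle_left _ _
  obtain ⟨hib, hklb⟩ := integrable_klReal_and_klReal_compProd μ κb κm ENNReal.ofNat_ne_top hb
  obtain ⟨hiφ, hklφ⟩ := integrable_klReal_and_klReal_compProd μ κφ κm ENNReal.ofNat_ne_top hφ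
  simp only [jsd, hmix, ← hκm]
  rw [hklb, hklφ, integral_add (hib.const_mul _) (hiφ.const_mul _), integral_const_mul,
    integral_const_mul]
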